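/- Let P ⊂ ℝ³ be a 3-dimensional one-point lattice simplex, i.e. a lattice simplex with the origin in its interior whose only lattice points are the origin and its four vertices. Then mult(P) ≤ 5, with equality if and only if P is unimodularly equivalent to conv{(1,0,0), (0,1,0), (1,2,5), (−2,−3,−5)}. -/

import Mathlib

/-- The canonical embedding of integer vectors into real vectors. -/
def toR {d : ℕ} (x : Fin d → ℤ) : Fin d → ℝ := fun j => (x j : ℝ)

/-- The lattice simplex (as a subset of `ℝ^d`) with vertex family `v`. -/
def hullOf {d : ℕ} (v : Fin (d + 1) → Fin d → ℤ) : Set (Fin d → ℝ) :=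
  convexHull ℝ (Set.range fun i => toR (v i))

/-- `v` is the vertex family of a `d`-dimensional one-point lattice simplex:
the vertices are affinely independent lattice points, the origin lies in the
interior, and the only lattice points of the simplex are the origin and the
vertices. -/
def IsOnePointSimplex {d : ℕ} (v : Fin (d + 1) → Fin d → ℤ) : Prop :=
  AffineIndependent ℝ (fun i => toR (v i)) ∧
  (0 : Fin d → ℝ) ∈ interior (hullOf v) ∧
  ∀ x : Fin d → ℤ, toR x ∈ hullOf v → x = 0 ∨ ∃ i, x = v i

/-- The multiplicity of the lattice simplex with vertex family `v`: the index in
`ℤ^d` of the subgroup generated by the vertices. -/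
noncomputable def mult {d : ℕ} (v : Fin (d + 1) → Fin d → ℤ) : ℕ :=
  (AddSubgroup.closure (Set.range v)).index

/-- Two subsets of `ℝ^d` are unimodularly equivalent if one is the image of the
other under `x ↦ A x + w` with `A ∈ GL_d(ℤ)` and `w ∈ ℤ^d`. -/
def UnimodEquiv {d : ℕ} (Q Q' : Set (Fin d → ℝ)) : Prop :=
  ∃ (A : Matrix (Fin d) (Fin d) ℤ) (w : Fin d → ℤ), IsUnit A.det ∧
    Q' = (fun x => (A.map fun n : ℤ => (n : ℝ)).mulVec x + toR w) '' Q

/-- `L` is the lattice of `V`-fold barycentric coordinates of the lattice points relative to a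
one-point simplex whose normalized volume is `V` and whose interior lattice point has
coordinates `d`. -/
structure IsOnePointLattice (L : AddSubgroup (Fin 4 → ℤ)) (V : ℤ) (d : Fin 4 → ℤ) : Prop where
  mem_of_dvd : ∀ c : Fin 4 → ℤ, (∀ i, V ∣ c i) → c ∈ L
  dvd_sum : ∀ c ∈ L, V ∣ c 0 + c 1 + c 2 + c 3
  eq_of_nonneg : ∀ c ∈ L, (∀ i, 0 ≤ c i) → c 0 + c 1 + c 2 + c 3 = V →
    c = d ∨ ∃ j, c j = V
  d_mem : d ∈ L
  d_pos : ∀ i, 0 < d i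
  d_sum : d 0 + d 1 + d 2 + d 3 = V

theorem fin_four_cases (i : Fin 4) : i = 0 ∨ i = 1 ∨ i = 2 ∨ i = 3 := by
  fin_cases i <;> simp

namespace IsOnePointLattice

variable {L : AddSubgroup (Fin 4 → ℤ)} {V : ℤ} {d : Fin 4 → ℤ}

theorem V_pos (h : IsOnePointLattice L V d) : 0 < V := by
  have := h.d_pos 0
  have := h.d_pos 1
  have := h.d_pos 2
  have := h.d_pos 3
  have := h.d_sum
  omega

theorem d_lt (h : IsOnePointLattice L V d) (i : Fin 4) : d i < V := by
  have := h.d_pos 0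
  have := h.d_pos 1
  have := h.d_pos 2
  have := h.d_pos 3
  have := h.d_sum
  rcases fin_four_cases i with rfl | rfl | rfl | rfl <;> omega

theorem add_lt (h : IsOnePointLattice L V d) {i j : Fin 4} (hij : i ≠ j) : d i + d j < V := by
  have := h.d_pos 0
  have := h.d_pos 1
  have := h.d_pos 2
  have := h.d_pos 3
  have := h.d_sum
  fin_cases i <;> fin_cases j <;> simp at hij ⊢ <;> omega

theorem not_dvd_d (h : IsOnePointLattice L V d) (i : Fin 4) : ¬ V ∣ d i := fun hi =>
  absurd (Int.le_of_dvd (h.d_pos i) hi) (not_le.2 (h.d_lt i))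

theorem two_mul_le_sum_emod (h : IsOnePointLattice L V d) {c : Fin 4 → ℤ} (hc : c ∈ L)
    (h0 : ¬ ∀ j, V ∣ c j) (hd : ¬ ∀ j, V ∣ c j - d j) :
    2 * V ≤ c 0 % V + c 1 % V + c 2 % V + c 3 % V := by
  have hV := h.V_pos
  have hr : (fun j => c j % V) ∈ L := by
    have := L.sub_mem hc (h.mem_of_dvd (fun j => V * (c j / V)) fun j => Dvd.intro _ rfl)
    convert this using 1
    ext j
    simp [Int.emod_def]
  have hnn : ∀ j, 0 ≤ c j % V := fun j => Int.emod_nonneg _ hV.ne'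
  have hlt : ∀ j, c j % V < V := fun j => Int.emod_lt_of_pos _ hV
  obtain ⟨k, hk⟩ := h.dvd_sum _ hr
  have n0 := hnn 0
  have n1 := hnn 1
  have n2 := hnn 2
  have n3 := hnn 3
  have hk0 : 0 ≤ k := by
    by_contra hneg
    nlinarith
  have hk0' : k ≠ 0 := by
    rintro rfl
    apply h0
    intro j
    apply Int.dvd_of_emod_eq_zero
    rcases fin_four_cases j with rfl | rfl | rfl | rfl <;> omega
  have hk1 : k ≠ 1 := by
    rintro rfl
    rcases h.eq_of_nonneg _ hr hnn (by rw [hk, mul_one]) with he | ⟨j, hj⟩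
    · apply hd
      intro j
      rw [← congrFun he j]
      exact Int.dvd_self_sub_emod
    · exact absurd hj (hlt j).ne
  have : 2 ≤ k := by omega
  rw [hk]
  nlinarith

theorem emod_add_neg_emod_le (hV : 0 < V) (a : ℤ) : a % V + (-a) % V ≤ V := by
  have h1 := Int.emod_nonneg a hV.ne'
  rcases h1.eq_or_lt with h0 | h0
  · have := Int.emod_lt_of_pos (-a) hV
    omega
  · have : (-a) % V = V - a % V := by
      rw [Int.neg_emod, if_neg (fun hd => h0.ne' (Int.emod_eq_zero_of_dvd hd)),
        Int.natAbs_of_nonneg hV.le]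
    omega

theorem dvd_of_dvd (h : IsOnePointLattice L V d) {c : Fin 4 → ℤ} (hc : c ∈ L) {i : Fin 4}
    (hi : V ∣ c i) (j : Fin 4) : V ∣ c j := by
  by_contra hj
  have hV := h.V_pos
  have h1 := h.two_mul_le_sum_emod hc (fun h' => hj (h' j))
    (fun h' => h.not_dvd_d i ((Int.dvd_iff_dvd_of_dvd_sub (h' i)).1 hi))
  have h2 := h.two_mul_le_sum_emod (L.neg_mem hc) (fun h' => hj (by simpa using h' j))
    (fun h' => h.not_dvd_d i ((Int.dvd_iff_dvd_of_dvd_sub (h' i)).1 (by simpa using hi)))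
  simp only [Pi.neg_apply] at h2
  have a0 := emod_add_neg_emod_le hV (c 0)
  have a1 := emod_add_neg_emod_le hV (c 1)
  have a2 := emod_add_neg_emod_le hV (c 2)
  have a3 := emod_add_neg_emod_le hV (c 3)
  have e1 : c i % V = 0 := Int.emod_eq_zero_of_dvd hi
  have e2 : -c i % V = 0 := Int.emod_eq_zero_of_dvd (by simpa using hi)
  rcases fin_four_cases i with rfl | rfl | rfl | rfl <;> omega

theorem sum_emod (h : IsOnePointLattice L V d) {c : Fin 4 → ℤ} (hc : c ∈ L) {i : Fin 4}
    (h0 : ¬ V ∣ c i) (hd : ¬ V ∣ c i - d i) (hd' : ¬ V ∣ c i + d i) :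
    c 0 % V + c 1 % V + c 2 % V + c 3 % V = 2 * V := by
  have hV := h.V_pos
  have h1 := h.two_mul_le_sum_emod hc (fun h' => h0 (h' i)) (fun h' => hd (h' i))
  have h2 := h.two_mul_le_sum_emod (L.neg_mem hc) (fun h' => h0 (by simpa using h' i))
    (fun h' => hd' ((Int.dvd_neg).1 (by
      convert h' i using 1
      simp only [Pi.neg_apply]
      ring)))
  simp only [Pi.neg_apply] at h2
  have a0 := emod_add_neg_emod_le hV (c 0)
  have a1 := emod_add_neg_emod_le hV (c 1)
  have a2 := emod_add_neg_emod_le hV (c 2)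
  have a3 := emod_add_neg_emod_le hV (c 3)
  omega

theorem sub_emod_eq (h : IsOnePointLattice L V d) (c : Fin 4 → ℤ) (j : Fin 4) :
    (c j - d j) % V = c j % V - d j + if c j % V < d j then V else 0 := by
  have hV := h.V_pos
  have h1 := Int.emod_nonneg (c j) hV.ne'
  have h2 := Int.emod_lt_of_pos (c j) hV
  have h3 := h.d_pos j
  have h4 := h.d_lt j
  rw [← Int.emod_sub_emod]
  split_ifs with hlt
  · rw [← Int.add_emod_right, Int.emod_eq_of_lt] <;> omega
  · rw [Int.emod_eq_of_lt] <;> omega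

/-- An element outside `{0, ± d, 2d}` has exactly one coordinate with residue below that
of `d`. -/
theorem exists_unique_small (h : IsOnePointLattice L V d) {c : Fin 4 → ℤ} (hc : c ∈ L)
    {i : Fin 4} (h0 : ¬ V ∣ c i) (hd : ¬ V ∣ c i - d i) (hd' : ¬ V ∣ c i + d i)
    (h2d : ¬ V ∣ c i - 2 * d i) :
    ∃ j, c j % V < d j ∧ ∀ k, k ≠ j → d k ≤ c k % V := by
  have h1 := h.sum_emod hc h0 hd hd'
  have h2 := h.sum_emod (L.sub_mem hc h.d_mem) (i := i) (by simpa using hd)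
    (by simpa [sub_sub, two_mul] using h2d) (by simpa using h0)
  simp only [Pi.sub_apply, h.sub_emod_eq] at h2
  have hs := h.d_sum
  have hV := h.V_pos
  by_cases c0 : c 0 % V < d 0 <;> by_cases c1 : c 1 % V < d 1 <;>
    by_cases c2 : c 2 % V < d 2 <;> by_cases c3 : c 3 % V < d 3 <;>
    simp only [c0, c1, c2, c3, if_true, if_false] at h2 <;> try (exfalso; omega)
  · exact ⟨0, c0, fun k hk => by fin_cases k <;> simp at hk ⊢ <;> omega⟩
  · exact ⟨1, c1, fun k hk => by fin_cases k <;> simp at hk ⊢ <;> omega⟩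
  · exact ⟨2, c2, fun k hk => by fin_cases k <;> simp at hk ⊢ <;> omega⟩
  · exact ⟨3, c3, fun k hk => by fin_cases k <;> simp at hk ⊢ <;> omega⟩

theorem two_mul_d_lt (h : IsOnePointLattice L V d) (i : Fin 4) : 2 * d i < V := by
  have hV := h.V_pos
  have hs := h.d_sum
  have hp := h.d_pos
  have p0 := hp 0
  have p1 := hp 1
  have p2 := hp 2
  have p3 := hp 3
  have h2 : d + d ∈ L := L.add_mem h.d_mem h.d_mem
  have key : ∃ j, ¬ V ∣ 2 * d j ∧ ¬ V ∣ 3 * d j := by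
    by_contra hcon
    push Not at hcon
    have hle : ∀ j, V ≤ 3 * d j := fun j => by
      by_cases hj : V ∣ 2 * d j
      · have := Int.le_of_dvd (by have := hp j; omega) hj
        have := hp j
        omega
      · exact Int.le_of_dvd (by have := hp j; omega) (hcon j hj)
    have := hle 0
    have := hle 1
    have := hle 2
    have := hle 3
    omega
  obtain ⟨j, hj2, hj3⟩ := key
  have := h.sum_emod h2 (i := j) (by simpa [two_mul] using hj2)
    (by simpa using h.not_dvd_d j) (by
      convert hj3 using 2
      simp only [Pi.add_apply]
      ring)
  simp only [Pi.add_apply, ← two_mul] at this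
  have le : ∀ k, 2 * d k % V ≤ 2 * d k := fun k => by
    have := mul_nonneg hV.le (Int.ediv_nonneg (a := 2 * d k) (by have := hp k; omega) hV.le)
    rw [Int.emod_def]
    omega
  have l0 := le 0
  have l1 := le 1
  have l2 := le 2
  have l3 := le 3
  have hi : 2 * d i % V = 2 * d i := by
    rcases fin_four_cases i with rfl | rfl | rfl | rfl <;> omega
  rw [← hi]
  exact Int.emod_lt_of_pos _ hV

theorem exists_eq_one (h : IsOnePointLattice L V d) {b : Fin 4 → ℤ} (hb : b ∈ L)
    (hb0 : b 0 = 1) (i : Fin 4) : ∃ c ∈ L, c i = 1 := by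
  have hV := h.V_pos
  obtain ⟨t, ht⟩ := Int.gcd_dvd_right (b i) V
  obtain ⟨r, hr⟩ := Int.gcd_dvd_left (b i) V
  have hg : (Int.gcd (b i) V : ℤ) = 1 := by
    have h1 : V ∣ (t • b) i := by
      refine ⟨r, ?_⟩
      simp only [Pi.smul_apply, smul_eq_mul]
      linear_combination t * hr - r * ht
    have h2 := h.dvd_of_dvd (L.zsmul_mem hb t) h1 0
    simp only [Pi.smul_apply, smul_eq_mul, hb0, mul_one] at h2
    have ht0 : t ≠ 0 := by
      rintro rfl
      omega
    have h3 : (Int.gcd (b i) V : ℤ) * t ∣ 1 * t := by rwa [← ht, one_mul]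
    have h4 := Int.dvd_of_mul_dvd_mul_right ht0 h3
    exact Int.eq_one_of_dvd_one (by positivity) h4
  have hcop : IsCoprime (b i) V := Int.isCoprime_iff_gcd_eq_one.2 (by exact_mod_cast hg)
  obtain ⟨u, w, huw⟩ := hcop
  refine ⟨u • b + fun _ => w * V, L.add_mem (L.zsmul_mem hb u)
    (h.mem_of_dvd _ fun _ => Dvd.intro_left _ rfl), ?_⟩
  simpa using huw

theorem dvd_d_of_dvd (h : IsOnePointLattice L V d) {m : ℤ} (hmV : m ∣ V) {i : Fin 4}
    (hmi : m ∣ d i) (j : Fin 4) : m ∣ d j := by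
  have hV := h.V_pos
  obtain ⟨t, ht⟩ := hmV
  have ht0 : t ≠ 0 := by
    rintro rfl
    omega
  have h1 : V ∣ (t • d) i := by
    rw [ht, mul_comm]
    exact mul_dvd_mul_left t hmi
  have h2 := h.dvd_of_dvd (L.zsmul_mem h.d_mem t) h1 j
  rw [ht, mul_comm] at h2
  exact Int.dvd_of_mul_dvd_mul_left ht0 h2

/-- If the vertices generate a proper sublattice, every coordinate is tied to another one by
an integral functional. -/
theorem exists_functional (h : IsOnePointLattice L V d) {m : ℤ} (hm : 2 ≤ m) (hmV : m ∣ V)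
    {i : Fin 4} (hmi : m ∣ d i) {b : Fin 4 → ℤ} (hb : b ∈ L) (hbi : b i = 1) :
    ∃ j, j ≠ i ∧ ∃ s, 0 < s ∧ s < d j ∧ s * d i + d j = V ∧
      ∀ x ∈ L, V ∣ x j + s * x i := by
  have hV := h.V_pos
  have hnot : ∀ t : ℤ, ¬ V ∣ (-b) i - t * d i := fun t ht => by
    have h1 : m ∣ (-b) i - t * d i := hmV.trans ht
    have h2 : m ∣ (-b) i := (Int.dvd_iff_dvd_of_dvd_sub h1).2 (hmi.mul_left t)
    simp only [Pi.neg_apply, hbi] at h2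
    have := Int.le_of_dvd one_pos (Int.dvd_neg.1 h2)
    omega
  obtain ⟨j, hj, -⟩ := h.exists_unique_small (L.neg_mem hb) (i := i)
    (by simpa using hnot 0) (by simpa using hnot 1) (by simpa using hnot (-1)) (hnot 2)
  have hji : j ≠ i := by
    rintro rfl
    have h1 : (-b) j % V = V - 1 := by
      have := h.d_pos j
      have := h.d_lt j
      rw [Pi.neg_apply, hbi, ← Int.add_emod_right, Int.emod_eq_of_lt] <;> omega
    have := h.two_mul_d_lt j
    have := h.d_pos j
    omega
  set s := (-b) j % V with hs
  have hs0 : s ≠ 0 := fun h0 => by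
    have := h.dvd_of_dvd (L.neg_mem hb) (Int.dvd_of_emod_eq_zero h0) i
    exact hnot 0 (by simpa using this)
  have hspos : 0 < s := lt_of_le_of_ne (Int.emod_nonneg _ hV.ne') hs0.symm
  have hfun : ∀ x ∈ L, V ∣ x j + s * x i := fun x hx => by
    have h1 : x - x i • b ∈ L := L.sub_mem hx (L.zsmul_mem hb _)
    have h2 := h.dvd_of_dvd h1 (i := i) (by simp [hbi]) j
    have h3 : V ∣ (-b) j - s := Int.dvd_self_sub_emod
    have h4 := h2.sub (h3.mul_left (x i))
    have h5 : x j + s * x i = (x - x i • b) j - x i * ((-b) j - s) := by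
      simp only [Pi.sub_apply, Pi.smul_apply, Pi.neg_apply, smul_eq_mul]
      ring
    rw [h5]
    exact h4
  have hd2 := h.two_mul_d_lt i
  have hpath : ∀ k : ℕ, (k : ℤ) < d i → d j ≤ V - k * s := by
    intro k
    induction k with
    | zero =>
      intro _
      simpa using (h.d_lt j).le
    | succ k ih =>
      intro hk
      push_cast at hk ⊢
      have ih' := ih (by omega)
      have hci : (((k : ℤ) + 1) • b) i = k + 1 := by simp [hbi]
      have ndvd : ∀ a : ℤ, 0 < a → a < V → ¬ V ∣ a := fun a ha haV hd =>
        absurd (Int.le_of_dvd ha hd) (not_le.2 haV)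
      obtain ⟨l, hl, huniq⟩ := h.exists_unique_small (L.zsmul_mem hb ((k : ℤ) + 1)) (i := i)
        (by rw [hci]; exact ndvd _ (by omega) (by omega))
        (by
          rw [hci, ← Int.dvd_neg]
          exact ndvd _ (by omega) (by omega))
        (by rw [hci]; exact ndvd _ (by omega) (by omega))
        (by
          rw [hci, ← Int.dvd_neg]
          exact ndvd _ (by omega) (by omega))
      have hil : i = l := by
        by_contra hil
        have := huniq i hil
        rw [hci, Int.emod_eq_of_lt] at this <;> omega
      have h1 := huniq j (by rw [← hil]; exact hji)
      have h2 := hfun _ (L.zsmul_mem hb ((k : ℤ) + 1))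
      rw [hci] at h2
      have h3 : (((k : ℤ) + 1) • b) j % V = (V - (k + 1) * s) := by
        have h4 : (V - (k + 1) * s) % V = V - (k + 1) * s := by
          apply Int.emod_eq_of_lt <;> nlinarith
        rw [← h4]
        refine Int.modEq_iff_dvd.2 ?_
        have h5 : V - (k + 1) * s - (((k : ℤ) + 1) • b) j =
            V - ((((k : ℤ) + 1) • b) j + s * (k + 1)) := by ring
        rw [h5]
        exact (dvd_refl V).sub h2
      omega
  refine ⟨j, hji, s, hspos, hj, ?_, hfun⟩
  have h1 := hpath (d i - 1).toNat (by have := h.d_pos i; omega)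
  rw [Int.toNat_of_nonneg (by have := h.d_pos i; omega)] at h1
  have h2 : V ∣ V - d j - s * d i := by
    have := hfun d h.d_mem
    rw [show V - d j - s * d i = V - (d j + s * d i) by ring]
    exact (dvd_refl V).sub this
  have h3 : |V - d j - s * d i| < V := by
    have := h.d_pos j
    have := h.d_lt j
    have : 0 < s * d i := mul_pos hspos (h.d_pos i)
    rw [abs_lt]
    constructor <;> nlinarith
  have := Int.eq_zero_of_abs_lt_dvd h2 h3
  omega

/-- Coordinate `j` is determined by coordinate `i` through an integral functional. -/
def Linked (L : AddSubgroup (Fin 4 → ℤ)) (V : ℤ) (d : Fin 4 → ℤ) (i j : Fin 4) : Prop :=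
  ∃ s, 0 < s ∧ s < d j ∧ s * d i + d j = V ∧ ∀ x ∈ L, V ∣ x j + s * x i

theorem Linked.not_symm (h : IsOnePointLattice L V d) {i j : Fin 4} (hij : i ≠ j)
    {b : Fin 4 → ℤ} (hb : b ∈ L) (hbi : b i = 1) (h1 : Linked L V d i j) :
    ¬ Linked L V d j i := by
  rintro ⟨t, ht0, ht1, ht2, ht3⟩
  obtain ⟨s, hs0, hs1, hs2, hs3⟩ := h1
  have e1 := hs3 b hb
  have e2 := ht3 b hb
  rw [hbi] at e1 e2
  have e3 : V ∣ t * s - 1 := by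
    rw [show t * s - 1 = t * (b j + s * 1) - (1 + t * b j) by ring]
    exact (e1.mul_left t).sub e2
  have h3 : |t * s - 1| < V := by
    have := h.d_pos i
    have := h.d_pos j
    rw [abs_lt]
    constructor <;> nlinarith
  have h4 := Int.eq_zero_of_abs_lt_dvd e3 h3
  have h5 : s = 1 := by
    have : s ∣ 1 := ⟨t, by linarith⟩
    exact Int.eq_one_of_dvd_one hs0.le this
  have := h.add_lt hij
  rw [h5] at hs2
  omega

end IsOnePointLattice

theorem dvd_one_of_three_cycle {m V d₀ d₁ d₂ d₃ s₀ s₁ s₂ s₃ : ℤ} (hV : 0 < V)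
    (h₀ : 0 < s₀) (h₁ : 0 < s₁) (h₂ : 0 < s₂) (hm₂ : m ∣ d₂) (hm₃ : m ∣ d₃)
    (hsum : d₀ + d₁ + d₂ + d₃ = V) (f₀ : s₀ * d₀ + d₁ = V) (f₁ : s₁ * d₁ + d₂ = V)
    (f₂ : s₂ * d₂ + d₀ = V) (f₃ : s₃ * d₃ + d₀ = V) (c : V ∣ s₀ * s₁ * s₂ + 1)
    (c' : V ∣ s₃ * (1 - s₀ + s₀ * s₁) - 1) : m ∣ 1 := by
  obtain ⟨e, he⟩ := c
  obtain ⟨t, ht⟩ := c'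
  have he0 : e ≠ 0 := by
    rintro rfl
    have : 0 < s₀ * s₁ * s₂ := by positivity
    omega
  have k₀ : d₀ * e = 1 - s₂ + s₁ * s₂ := by
    apply mul_left_cancel₀ hV.ne'
    linear_combination -d₀ * he + s₁ * s₂ * f₀ - s₂ * f₁ + f₂
  have k₁ : d₁ * e = 1 - s₀ + s₂ * s₀ := by
    apply mul_left_cancel₀ hV.ne'
    linear_combination -d₁ * he + s₂ * s₀ * f₁ - s₀ * f₂ + f₀
  have k₂ : d₂ * e = 1 - s₁ + s₀ * s₁ := by
    apply mul_left_cancel₀ hV.ne'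
    linear_combination -d₂ * he + s₀ * s₁ * f₂ - s₁ * f₀ + f₁
  have k₃ : d₃ * t = (s₀ - 1) * (s₁ - 1) + 1 := by
    apply mul_left_cancel₀ (mul_ne_zero hV.ne' he0)
    have k : d₃ * e = s₀ * s₁ * s₂ + 1 - (1 - s₂ + s₁ * s₂) - (1 - s₀ + s₂ * s₀) -
        (1 - s₁ + s₀ * s₁) := by
      linear_combination e * hsum - k₀ - k₁ - k₂ - he
    have k' : (V - d₀) * e = s₀ * s₁ * s₂ + 1 - (1 - s₂ + s₁ * s₂) := by
      linear_combination -he - k₀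
    linear_combination -d₃ * e * ht + e * (1 - s₀ + s₀ * s₁) * f₃ +
      (1 - s₀ + s₀ * s₁) * k' - k + ((s₀ - 1) * (s₁ - 1) + 1) * he
  have m₂ : m ∣ 1 - s₁ + s₀ * s₁ := k₂ ▸ hm₂.mul_right e
  have m₃ : m ∣ (s₀ - 1) * (s₁ - 1) + 1 := k₃ ▸ hm₃.mul_right t
  have mq : m ∣ s₀ - 1 := by
    rw [show s₀ - 1 = 1 - s₁ + s₀ * s₁ - ((s₀ - 1) * (s₁ - 1) + 1) by ring]
    exact m₂.sub m₃
  rw [show (1 : ℤ) = 1 - s₁ + s₀ * s₁ - s₁ * (s₀ - 1) by ring]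
  exact m₂.sub (mq.mul_left s₁)

theorem Int.eq_one_or_two_of_mul_eq {q a n : ℤ} (ha : 0 < a) (hn : 0 < n) (hle : n ≤ 2 * a)
    (h : n = a * q) : q = 1 ∨ q = 2 := by
  have h1 : 0 < q := pos_of_mul_pos_right (h ▸ hn) ha.le
  have h2 : q ≤ 2 := by
    by_contra hcon
    nlinarith
  omega

theorem Int.eq_one_or_of_dvd_prime {a p : ℤ} (hp : Prime p) (hp0 : 0 < p) (ha : 0 < a)
    (h : a ∣ p) : a = 1 ∨ a = p := by
  obtain ⟨b, hb⟩ := h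
  rcases hp.irreducible.isUnit_or_isUnit hb with hu | hu
  · rcases Int.isUnit_iff.1 hu with h1 | h1 <;> omega
  · rcases Int.isUnit_iff.1 hu with rfl | rfl <;> omega

theorem classification_of_dvd {a b c : ℤ} (ha : 0 < a) (hb : 0 < b) (hc : 0 < c)
    (hab : IsCoprime a b) (hac : IsCoprime a c) (hbc : IsCoprime b c) (hle : a < b + c)
    (h₁ : a ∣ b + 2 * c) (h₂ : b ∣ a + c) (h₃ : c ∣ a + b) :
    (a = 1 ∧ b = 1 ∧ c = 1) ∨ (a = 1 ∧ b = 1 ∧ c = 2) ∨ (a = 1 ∧ b = 2 ∧ c = 1) ∨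
    (a = 1 ∧ b = 2 ∧ c = 3) ∨ (a = 1 ∧ b = 3 ∧ c = 2) ∨ (a = 3 ∧ b = 1 ∧ c = 4) ∨
    (a = 3 ∧ b = 4 ∧ c = 1) ∨ (a = 3 ∧ b = 2 ∧ c = 5) ∨ (a = 3 ∧ b = 5 ∧ c = 2) ∨
    (a = 5 ∧ b = 4 ∧ c = 3) := by
  have one_of_eq : ∀ {x y : ℤ}, 0 < x → IsCoprime x y → x = y → x = 1 := by
    rintro x _ hx hxy rfl
    rcases Int.isUnit_iff.1 (isCoprime_self.1 hxy) with h | h <;> omega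
  by_cases hbmax : a ≤ b ∧ c ≤ b
  · obtain ⟨q, hq⟩ := h₂
    rcases Int.eq_one_or_two_of_mul_eq hb (by omega) (by omega) hq with rfl | rfl
    · obtain rfl : b = a + c := by omega
      have hc2 : c ∣ 2 := by
        have : c ∣ 2 * a := by
          rw [show 2 * a = a + (a + c) - c by ring]
          exact h₃.sub dvd_rfl
        exact hac.symm.dvd_of_dvd_mul_right this
      have ha3 : a ∣ 3 := by
        have : a ∣ 3 * c := by
          rw [show 3 * c = a + c + 2 * c - a by ring]
          exact h₁.sub dvd_rfl
        exact hac.dvd_of_dvd_mul_right this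
      have h₂' := Int.eq_one_or_of_dvd_prime Int.prime_two (by norm_num) hc hc2
      have h₃' := Int.eq_one_or_of_dvd_prime Int.prime_three (by norm_num) ha ha3
      rcases h₂' with rfl | rfl <;> rcases h₃' with rfl | rfl <;> decide
    · have := one_of_eq hb hbc (by omega)
      exact Or.inl (by omega)
  by_cases hcmax : a ≤ c ∧ b ≤ c
  · obtain ⟨q, hq⟩ := h₃
    rcases Int.eq_one_or_two_of_mul_eq hc (by omega) (by omega) hq with rfl | rfl
    · obtain rfl : c = a + b := by omega
      have hb2 : b ∣ 2 := by
        have : b ∣ 2 * a := by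
          rw [show 2 * a = a + (a + b) - b by ring]
          exact h₂.sub dvd_rfl
        exact hab.symm.dvd_of_dvd_mul_right this
      have ha3 : a ∣ 3 := by
        have : a ∣ 3 * b := by
          rw [show 3 * b = b + 2 * (a + b) - a * 2 by ring]
          exact h₁.sub (Dvd.intro _ rfl)
        exact hab.dvd_of_dvd_mul_right this
      have h₂' := Int.eq_one_or_of_dvd_prime Int.prime_two (by norm_num) hb hb2
      have h₃' := Int.eq_one_or_of_dvd_prime Int.prime_three (by norm_num) ha ha3
      rcases h₂' with rfl | rfl <;> rcases h₃' with rfl | rfl <;> decide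
    · have := one_of_eq hb hbc (by omega)
      exact Or.inl (by omega)
  have hba : b < a := by omega
  have hca : c < a := by omega
  obtain ⟨q, hq⟩ := h₁
  have hq1 : 1 < q := by
    by_contra hcon
    nlinarith
  have hq3 : q < 3 := by
    by_contra hcon
    nlinarith
  obtain rfl : q = 2 := by omega
  have hb4 : b ∣ 4 := by
    have : b ∣ 4 * c := by
      rw [show 4 * c = 2 * (a + c) - b by omega]
      exact (h₂.mul_left 2).sub dvd_rfl
    exact hbc.dvd_of_dvd_mul_right this
  have hc3 : c ∣ 3 := by
    have : c ∣ 3 * b := by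
      rw [show 3 * b = 2 * (a + b) - c * 2 by omega]
      exact (h₃.mul_left 2).sub (Dvd.intro _ rfl)
    exact hbc.symm.dvd_of_dvd_mul_right this
  have hb4' := Int.le_of_dvd (by norm_num) hb4
  have hb3 : b ≠ 3 := by
    rintro rfl
    omega
  have hb2 : b ≠ 2 := by
    rintro rfl
    rcases Int.eq_one_or_of_dvd_prime Int.prime_three (by norm_num) hc hc3 with rfl | rfl
    · omega
    · obtain rfl : a = 4 := by omega
      norm_num [Int.isCoprime_iff_gcd_eq_one] at hab
  rcases Int.eq_one_or_of_dvd_prime Int.prime_three (by norm_num) hc hc3 with rfl | rfl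
  · obtain rfl : b = 4 := by omega
    obtain rfl : a = 3 := by omega
    decide
  · obtain rfl : b = 4 := by omega
    obtain rfl : a = 5 := by omega
    decide

theorem false_of_mul_dvd {m h n₀ n₁ n₂ n₃ : ℤ} (hm : 2 ≤ m) (hh : 0 < h)
    (c₀ : m * h ∣ n₀) (c₁ : m * h ∣ n₁) (c₂ : m * h ∣ n₂) (c₃ : m * h ∣ n₃)
    (x₀ x₁ x₂ x₃ : ℤ) (e : n₀ * x₀ + n₁ * x₁ + n₂ * x₂ + n₃ * x₃ = h) : False := by
  have hdvd := (((c₀.mul_right x₀).add (c₁.mul_right x₁)).add (c₂.mul_right x₂)).add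
    (c₃.mul_right x₃)
  rw [e] at hdvd
  have := Int.le_of_dvd hh hdvd
  nlinarith

theorem four_cycle_weights {m w₀ w₁ w₂ w₃ s₀ s₁ s₂ s₃ : ℤ} (hm : 2 ≤ m)
    (p₀ : 0 < w₀) (p₁ : 0 < w₁) (p₂ : 0 < w₂) (p₃ : 0 < w₃)
    (prim : ∀ g, g ∣ w₀ → g ∣ w₁ → g ∣ w₂ → g ∣ w₃ → IsUnit g)
    (f₀ : s₀ * w₀ + w₁ = w₀ + w₁ + w₂ + w₃) (f₁ : s₁ * w₁ + w₂ = w₀ + w₁ + w₂ + w₃)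
    (f₂ : s₂ * w₂ + w₃ = w₀ + w₁ + w₂ + w₃) (f₃ : s₃ * w₃ + w₀ = w₀ + w₁ + w₂ + w₃)
    (c₀ : m * (w₀ + w₁ + w₂ + w₃) ∣ s₀ * s₁ * s₂ - s₀ * s₁ + s₀ - 1)
    (c₁ : m * (w₀ + w₁ + w₂ + w₃) ∣ s₁ * s₂ * s₃ - s₁ * s₂ + s₁ - 1)
    (c₂ : m * (w₀ + w₁ + w₂ + w₃) ∣ s₂ * s₃ * s₀ - s₂ * s₃ + s₂ - 1)
    (c₃ : m * (w₀ + w₁ + w₂ + w₃) ∣ s₃ * s₀ * s₁ - s₃ * s₀ + s₃ - 1)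
    (l₁ : w₁ ≤ w₀) (l₂ : w₂ ≤ w₀) (l₃ : w₃ ≤ w₀) :
    m = 5 ∧ w₀ = 1 ∧ w₁ = 1 ∧ w₂ = 1 ∧ w₃ = 1 := by
  have g₁ : w₁ * (s₁ - 1) = w₃ + w₀ := by linarith
  have g₂ : w₂ * (s₂ - 1) = w₀ + w₁ := by linarith
  have g₃ : w₃ * (s₃ - 1) = w₁ + w₂ := by linarith
  rcases Int.eq_one_or_two_of_mul_eq (q := s₀ - 1) p₀ (n := w₂ + w₃) (by omega) (by omega)
    (by linarith) with h | h
  · obtain rfl : s₀ = 2 := by omega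
    obtain rfl : w₀ = w₂ + w₃ := by omega
    have d₂ : w₂ ∣ w₁ + w₃ := by
      rw [show w₁ + w₃ = w₂ * (s₂ - 1) - w₂ by linarith]
      exact (Dvd.intro _ rfl).sub dvd_rfl
    have d₃ : w₃ ∣ w₁ + w₂ := ⟨_, g₃.symm⟩
    have d₁ : w₁ ∣ w₂ + 2 * w₃ := ⟨s₁ - 1, by linarith⟩
    have cop : ∀ {x y : ℤ}, (∀ g, g ∣ x → g ∣ y → g ∣ w₁ ∧ g ∣ w₂ ∧ g ∣ w₃) →
        IsCoprime x y := fun {x y} hg => by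
      obtain ⟨e₁, e₂, e₃⟩ := hg _ (Int.gcd_dvd_left x y) (Int.gcd_dvd_right x y)
      rw [Int.isCoprime_iff_gcd_eq_one]
      exact Int.isUnit_iff_natAbs_eq.1 (prim _ (e₂.add e₃) e₁ e₂ e₃)
    have hlt : w₁ ≠ w₂ + w₃ := by
      rintro rfl
      have e : w₂ + w₃ ∣ w₃ := by
        have e := d₁.sub (dvd_refl (w₂ + w₃))
        rwa [show w₂ + 2 * w₃ - (w₂ + w₃) = w₃ by ring] at e
      have := Int.le_of_dvd p₃ e
      omega
    rcases classification_of_dvd p₁ p₂ p₃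
      (cop fun g ha hb => ⟨ha, hb, (Int.dvd_iff_dvd_of_dvd_add (hb.trans d₂)).1 ha⟩)
      (cop fun g ha hc => ⟨ha, (Int.dvd_iff_dvd_of_dvd_add (hc.trans d₃)).1 ha, hc⟩)
      (cop fun g hb hc => ⟨(Int.dvd_iff_dvd_of_dvd_add (hb.trans d₂)).2 hc, hb, hc⟩)
      (by omega) d₁ d₂ d₃ with
      ⟨rfl, rfl, rfl⟩ | ⟨rfl, rfl, rfl⟩ | ⟨rfl, rfl, rfl⟩ | ⟨rfl, rfl, rfl⟩ | ⟨rfl, rfl, rfl⟩ |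
      ⟨rfl, rfl, rfl⟩ | ⟨rfl, rfl, rfl⟩ | ⟨rfl, rfl, rfl⟩ | ⟨rfl, rfl, rfl⟩ | ⟨rfl, rfl, rfl⟩
    · obtain rfl : s₁ = 4 := by omega
      obtain rfl : s₂ = 4 := by omega
      obtain rfl : s₃ = 3 := by omega
      exact (false_of_mul_dvd hm (by norm_num) c₀ c₁ c₂ c₃ 0 0 (-1) 1 (by norm_num)).elim
    · obtain rfl : s₁ = 6 := by omega
      obtain rfl : s₂ = 5 := by omega
      obtain rfl : s₃ = 2 := by omega
      exact (false_of_mul_dvd hm (by norm_num) c₀ c₁ c₂ c₃ 0 0 (-1) 1 (by norm_num)).elim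
    · obtain rfl : s₁ = 5 := by omega
      obtain rfl : s₂ = 3 := by omega
      obtain rfl : s₃ = 4 := by omega
      exact (false_of_mul_dvd hm (by norm_num) c₀ c₁ c₂ c₃ 1 0 (-1) 0 (by norm_num)).elim
    · obtain rfl : s₁ = 9 := by omega
      obtain rfl : s₂ = 4 := by omega
      obtain rfl : s₃ = 2 := by omega
      exact (false_of_mul_dvd hm (by norm_num) c₀ c₁ c₂ c₃ 0 0 1 0 (by norm_num)).elim
    · obtain rfl : s₁ = 8 := by omega
      obtain rfl : s₂ = 3 := by omega
      obtain rfl : s₃ = 3 := by omega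
      exact (false_of_mul_dvd hm (by norm_num) c₀ c₁ c₂ c₃ 0 0 1 0 (by norm_num)).elim
    · obtain rfl : s₁ = 4 := by omega
      obtain rfl : s₂ = 9 := by omega
      obtain rfl : s₃ = 2 := by omega
      exact (false_of_mul_dvd hm (by norm_num) c₀ c₁ c₂ c₃ 0 0 0 1 (by norm_num)).elim
    · obtain rfl : s₁ = 3 := by omega
      obtain rfl : s₂ = 3 := by omega
      obtain rfl : s₃ = 8 := by omega
      exact (false_of_mul_dvd hm (by norm_num) c₀ c₁ c₂ c₃ 1 0 0 0 (by norm_num)).elim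
    · obtain rfl : s₁ = 5 := by omega
      obtain rfl : s₂ = 6 := by omega
      obtain rfl : s₃ = 2 := by omega
      exact (false_of_mul_dvd hm (by norm_num) c₀ c₁ c₂ c₃ 0 0 0 1 (by norm_num)).elim
    · obtain rfl : s₁ = 4 := by omega
      obtain rfl : s₂ = 3 := by omega
      obtain rfl : s₃ = 5 := by omega
      exact (false_of_mul_dvd hm (by norm_num) c₀ c₁ c₂ c₃ 0 0 1 0 (by norm_num)).elim
    · obtain rfl : s₁ = 3 := by omega
      obtain rfl : s₂ = 4 := by omega
      obtain rfl : s₃ = 4 := by omega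
      exact (false_of_mul_dvd hm (by norm_num) c₀ c₁ c₂ c₃ 0 0 0 1 (by norm_num)).elim
  · obtain rfl : s₀ = 3 := by omega
    obtain rfl : w₂ = w₀ := by omega
    obtain rfl : w₃ = w₂ := by omega
    have e : w₃ ∣ w₁ := by
      rw [show w₁ = w₃ * (s₃ - 1) - w₃ by linarith]
      exact (Dvd.intro _ rfl).sub dvd_rfl
    have hu := prim w₃ dvd_rfl e dvd_rfl dvd_rfl
    obtain rfl : w₃ = 1 := by
      rcases Int.isUnit_iff.1 hu with h | h <;> omega
    obtain rfl : w₁ = 1 := by omega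
    obtain rfl : s₁ = 3 := by omega
    obtain rfl : s₂ = 3 := by omega
    norm_num at c₀ ⊢
    have h5 : m ∣ 5 := by
      obtain ⟨k, hk⟩ := c₀
      exact ⟨k, by linarith⟩
    rcases Int.eq_one_or_of_dvd_prime (Int.prime_iff_natAbs_prime.2 (by norm_num))
      (by norm_num) (by omega) h5 with rfl | rfl <;> omega

set_option synthInstance.maxHeartbeats 200000 in
set_option synthInstance.maxSize 1000 in
theorem exists_perm_cycle : ∀ (σ : Fin 4 → Fin 4) (i₀ : Fin 4), (∀ i, σ i ≠ i) →
    (∀ i, σ (σ i) ≠ i) →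
    (∃ τ : Equiv.Perm (Fin 4), σ (τ 0) = τ 1 ∧ σ (τ 1) = τ 2 ∧ σ (τ 2) = τ 0 ∧ σ (τ 3) = τ 0) ∨
    (∃ τ : Equiv.Perm (Fin 4), τ 0 = i₀ ∧
      σ (τ 0) = τ 1 ∧ σ (τ 1) = τ 2 ∧ σ (τ 2) = τ 3 ∧ σ (τ 3) = τ 0) := by
  decide +kernel

namespace IsOnePointLattice

variable {L : AddSubgroup (Fin 4 → ℤ)} {V : ℤ} {d : Fin 4 → ℤ}

theorem dvd_sum_perm (h : IsOnePointLattice L V d) (τ : Equiv.Perm (Fin 4)) {c : Fin 4 → ℤ}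
    (hc : c ∈ L) : V ∣ c (τ 0) + c (τ 1) + c (τ 2) + c (τ 3) := by
  rw [← Fin.sum_univ_four (fun i => c (τ i)), Equiv.sum_comp τ c, Fin.sum_univ_four]
  exact h.dvd_sum c hc

theorem d_sum_perm (h : IsOnePointLattice L V d) (τ : Equiv.Perm (Fin 4)) :
    d (τ 0) + d (τ 1) + d (τ 2) + d (τ 3) = V := by
  rw [← Fin.sum_univ_four (fun i => d (τ i)), Equiv.sum_comp τ d, Fin.sum_univ_four]
  exact h.d_sum

theorem dvd_one_of_linked (h : IsOnePointLattice L V d) {m : ℤ} (hmd : ∀ i, m ∣ d i)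
    (hb : ∀ i, ∃ b ∈ L, b i = 1) (τ : Equiv.Perm (Fin 4)) (l₀ : Linked L V d (τ 0) (τ 1))
    (l₁ : Linked L V d (τ 1) (τ 2)) (l₂ : Linked L V d (τ 2) (τ 0))
    (l₃ : Linked L V d (τ 3) (τ 0)) : m ∣ 1 := by
  obtain ⟨b, hbL, hb1⟩ := hb (τ 0)
  obtain ⟨s₀, p₀, -, f₀, x₀⟩ := l₀
  obtain ⟨s₁, p₁, -, f₁, x₁⟩ := l₁
  obtain ⟨s₂, p₂, -, f₂, x₂⟩ := l₂
  obtain ⟨s₃, p₃, -, f₃, x₃⟩ := l₃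
  obtain ⟨k₀, e₀⟩ := x₀ b hbL
  obtain ⟨k₁, e₁⟩ := x₁ b hbL
  obtain ⟨k₂, e₂⟩ := x₂ b hbL
  obtain ⟨k₃, e₃⟩ := x₃ b hbL
  obtain ⟨k, e⟩ := h.dvd_sum_perm τ hbL
  rw [hb1] at e₀ e₂ e₃ e
  refine dvd_one_of_three_cycle h.V_pos p₀ p₁ p₂ (hmd (τ 2)) (hmd (τ 3)) (h.d_sum_perm τ)
    f₀ f₁ f₂ f₃ ⟨k₂ - s₂ * k₁ + s₂ * s₁ * k₀, ?_⟩
    ⟨-k₃ + s₃ * (k - k₁ - k₀ + s₁ * k₀), ?_⟩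
  · linear_combination e₂ - s₂ * e₁ + s₂ * s₁ * e₀
  · linear_combination -e₃ + s₃ * (e - e₁ - e₀ + s₁ * e₀)

theorem eq_five_of_linked (h : IsOnePointLattice L V d) {m : ℤ} (hm : 2 ≤ m)
    (hmd : ∀ i, m ∣ d i) (hmax : ∀ g i, g ∣ V → g ∣ d i → g ∣ m)
    (hb : ∀ i, ∃ b ∈ L, b i = 1) (τ : Equiv.Perm (Fin 4)) (hle : ∀ i, d i ≤ d (τ 0))
    (l₀ : Linked L V d (τ 0) (τ 1)) (l₁ : Linked L V d (τ 1) (τ 2))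
    (l₂ : Linked L V d (τ 2) (τ 3)) (l₃ : Linked L V d (τ 3) (τ 0)) :
    m = 5 ∧ V = 20 ∧ (∀ i, d i = 5) ∧ ∀ x ∈ L, 20 ∣ x (τ 1) + 3 * x (τ 0) ∧
      20 ∣ x (τ 2) + 3 * x (τ 1) ∧ 20 ∣ x (τ 3) + 3 * x (τ 2) := by
  have hm0 : m ≠ 0 := by omega
  have hV := h.V_pos
  choose w hw using hmd
  have hwpos : ∀ i, 0 < w i := fun i =>
    pos_of_mul_pos_right (by rw [← hw]; exact h.d_pos i) (by omega : 0 ≤ m)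
  have hwle : ∀ i, w i ≤ w (τ 0) := fun i => by
    have := hle i
    rw [hw, hw (τ 0)] at this
    exact le_of_mul_le_mul_left this (by omega)
  have hVm : V = m * (w (τ 0) + w (τ 1) + w (τ 2) + w (τ 3)) := by
    rw [← h.d_sum_perm τ, hw (τ 0), hw (τ 1), hw (τ 2), hw (τ 3)]
    ring
  have key : ∀ {a b c e : Fin 4} {s t u : ℤ}, (∀ x ∈ L, V ∣ x a + x b + x c + x e) →
      (∀ x ∈ L, V ∣ x b + s * x a) → (∀ x ∈ L, V ∣ x c + t * x b) →
      (∀ x ∈ L, V ∣ x e + u * x c) → V ∣ s * t * u - s * t + s - 1 := by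
    intro a b c e s t u H₀ H₁ H₂ H₃
    obtain ⟨x, hx, hx1⟩ := hb a
    obtain ⟨k₀, e₀⟩ := H₀ x hx
    obtain ⟨k₁, e₁⟩ := H₁ x hx
    obtain ⟨k₂, e₂⟩ := H₂ x hx
    obtain ⟨k₃, e₃⟩ := H₃ x hx
    rw [hx1] at e₀ e₁
    refine ⟨-k₀ + k₃ + k₂ - u * k₂ + k₁ - t * k₁ + u * t * k₁, ?_⟩
    linear_combination -e₀ + e₃ + e₂ - u * e₂ + e₁ - t * e₁ + u * t * e₁
  have fw : ∀ {i j : Fin 4} {s : ℤ}, s * d i + d j = V →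
      s * w i + w j = w (τ 0) + w (τ 1) + w (τ 2) + w (τ 3) := by
    intro i j s hs
    apply mul_left_cancel₀ hm0
    rw [← hVm, ← hs, hw i, hw j]
    ring
  obtain ⟨s₀, p₀, -, f₀, x₀⟩ := l₀
  obtain ⟨s₁, p₁, -, f₁, x₁⟩ := l₁
  obtain ⟨s₂, p₂, -, f₂, x₂⟩ := l₂
  obtain ⟨s₃, p₃, -, f₃, x₃⟩ := l₃
  have hs : ∀ x ∈ L, V ∣ x (τ 0) + x (τ 1) + x (τ 2) + x (τ 3) := fun x hx =>
    h.dvd_sum_perm τ hx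
  obtain ⟨hm5, w₀, w₁, w₂, w₃⟩ := four_cycle_weights (m := m) hm (hwpos (τ 0)) (hwpos (τ 1))
    (hwpos (τ 2)) (hwpos (τ 3))
    (fun g g₀ g₁ g₂ g₃ => by
      have h1 : m * g ∣ m * 1 := by
        rw [mul_one]
        refine hmax _ (τ 0) ?_ ?_
        · rw [hVm]
          exact mul_dvd_mul_left m (((g₀.add g₁).add g₂).add g₃)
        · rw [hw]
          exact mul_dvd_mul_left m g₀
      exact isUnit_of_dvd_one ((mul_dvd_mul_iff_left hm0).1 h1))
    (fw f₀) (fw f₁) (fw f₂) (fw f₃)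
    (hVm ▸ key hs x₀ x₁ x₂)
    (hVm ▸ key (fun x hx => by convert hs x hx using 1; ring) x₁ x₂ x₃)
    (hVm ▸ key (fun x hx => by convert hs x hx using 1; ring) x₂ x₃ x₀)
    (hVm ▸ key (fun x hx => by convert hs x hx using 1; ring) x₃ x₀ x₁)
    (hwle _) (hwle _) (hwle _)
  have hV20 : V = 20 := by
    rw [hVm, hm5, w₀, w₁, w₂, w₃]
    norm_num
  have hd₀ := hw (τ 0)
  have hd₁ := hw (τ 1)
  have hd₂ := hw (τ 2)
  have hd₃ := hw (τ 3)
  rw [hm5, w₀] at hd₀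
  rw [hm5, w₁] at hd₁
  rw [hm5, w₂] at hd₂
  rw [hm5, w₃] at hd₃
  rw [hV20] at x₀ x₁ x₂
  rw [hV20, hd₀, hd₁] at f₀
  rw [hV20, hd₁, hd₂] at f₁
  rw [hV20, hd₂, hd₃] at f₂
  obtain rfl : s₀ = 3 := by omega
  obtain rfl : s₁ = 3 := by omega
  obtain rfl : s₂ = 3 := by omega
  refine ⟨hm5, hV20, fun i => ?_, fun x hx => ⟨x₀ x hx, x₁ x hx, x₂ x hx⟩⟩
  obtain ⟨j, rfl⟩ := τ.surjective i
  rcases fin_four_cases j with rfl | rfl | rfl | rfl <;> assumption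

theorem gcd_eq_one_or (h : IsOnePointLattice L V d) {b : Fin 4 → ℤ} (hbL : b ∈ L)
    (hb0 : b 0 = 1) : Int.gcd V (d 0) = 1 ∨ (Int.gcd V (d 0) = 5 ∧ V = 20 ∧ (∀ i, d i = 5) ∧
      ∃ τ : Equiv.Perm (Fin 4), ∀ x ∈ L, 20 ∣ x (τ 1) + 3 * x (τ 0) ∧
      20 ∣ x (τ 2) + 3 * x (τ 1) ∧ 20 ∣ x (τ 3) + 3 * x (τ 2)) := by
  refine or_iff_not_imp_left.2 fun hne => ?_
  have hpos : 0 < Int.gcd V (d 0) := Int.gcd_pos_of_ne_zero_left _ h.V_pos.ne'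
  have hm : (2 : ℤ) ≤ (Int.gcd V (d 0) : ℤ) := by omega
  have hmd := h.dvd_d_of_dvd (Int.gcd_dvd_left V (d 0)) (Int.gcd_dvd_right V (d 0))
  have hb := h.exists_eq_one hbL hb0
  have hex : ∀ i, ∃ j, j ≠ i ∧ Linked L V d i j := fun i => by
    obtain ⟨c, hc, hci⟩ := hb i
    exact h.exists_functional hm (Int.gcd_dvd_left V (d 0)) (hmd i) hc hci
  choose σ hσ hlink using hex
  obtain ⟨i₀, hi₀⟩ := Finite.exists_max d
  rcases exists_perm_cycle σ i₀ hσ (fun i hi => by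
    obtain ⟨c, hc, hci⟩ := hb i
    have h2 := hlink (σ i)
    rw [hi] at h2
    exact Linked.not_symm h (hσ i).symm hc hci (hlink i) h2) with
    ⟨τ, t₀, t₁, t₂, t₃⟩ | ⟨τ, rfl, t₀, t₁, t₂, t₃⟩
  · have := Int.le_of_dvd one_pos (h.dvd_one_of_linked hmd hb τ (t₀ ▸ hlink _) (t₁ ▸ hlink _)
      (t₂ ▸ hlink _) (t₃ ▸ hlink _))
    omega
  · obtain ⟨h5, hV, hd, hx⟩ := h.eq_five_of_linked hm hmd (fun g i hgV hgi =>
      Int.dvd_coe_gcd hgV (h.dvd_d_of_dvd hgV hgi 0)) hb τ hi₀ (t₀ ▸ hlink _) (t₁ ▸ hlink _)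
      (t₂ ▸ hlink _) (t₃ ▸ hlink _)
    exact ⟨by exact_mod_cast h5, hV, hd, τ, hx⟩

end IsOnePointLattice

/-- The square matrix whose rows are the vertices in homogeneous coordinates. -/
def homogMatrix (v : Fin 4 → Fin 3 → ℤ) : Matrix (Fin 4) (Fin 4) ℤ :=
  Matrix.of fun i => Fin.cons 1 (v i)

theorem homogMatrix_zero (v : Fin 4 → Fin 3 → ℤ) (i : Fin 4) : homogMatrix v i 0 = 1 := rfl

theorem homogMatrix_succ (v : Fin 4 → Fin 3 → ℤ) (i : Fin 4) (k : Fin 3) :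
    homogMatrix v i k.succ = v i k := rfl

theorem vecMul_map_homogMatrix_iff (v : Fin 4 → Fin 3 → ℤ) (w y : Fin 4 → ℝ) :
    Matrix.vecMul w ((homogMatrix v).map fun n : ℤ => (n : ℝ)) = y ↔
      ∑ i, w i = y 0 ∧ ∑ i, w i • toR (v i) = Fin.tail y := by
  have h0 : Matrix.vecMul w ((homogMatrix v).map fun n : ℤ => (n : ℝ)) 0 = ∑ i, w i := by
    simp [Matrix.vecMul, dotProduct, homogMatrix_zero]
  have h1 : Fin.tail (Matrix.vecMul w ((homogMatrix v).map fun n : ℤ => (n : ℝ))) =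
      ∑ i, w i • toR (v i) := by
    ext k
    simp [Fin.tail, Matrix.vecMul, dotProduct, homogMatrix_succ, toR]
  rw [← h0, ← h1]
  constructor
  · rintro rfl
    exact ⟨rfl, rfl⟩
  · rintro ⟨e, e'⟩
    rw [← Fin.cons_self_tail (Matrix.vecMul _ _), e, e', Fin.cons_self_tail]

theorem det_map_homogMatrix (v : Fin 4 → Fin 3 → ℤ) :
    ((homogMatrix v).map fun n : ℤ => (n : ℝ)).det = ((homogMatrix v).det : ℝ) :=
  ((Int.castRingHom ℝ).map_det (homogMatrix v)).symm

theorem affineIndependent_iff_det_homogMatrix_ne_zero (v : Fin 4 → Fin 3 → ℤ) :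
    AffineIndependent ℝ (fun i => toR (v i)) ↔ (homogMatrix v).det ≠ 0 := by
  rw [← Int.cast_ne_zero (α := ℝ), ← det_map_homogMatrix, ← not_iff_not, not_not,
    ← Matrix.exists_vecMul_eq_zero_iff, affineIndependent_iff]
  simp only [vecMul_map_homogMatrix_iff]
  push Not
  constructor
  · rintro ⟨s, w, h0, h1, e, he, hne⟩
    refine ⟨fun i => if i ∈ s then w i else 0, fun h => hne ?_, ?_, ?_⟩
    · simpa [he] using congrFun h e
    · simpa using h0
    · simp only [ite_smul, zero_smul, Finset.sum_ite_mem, Finset.univ_inter]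
      exact h1
  · rintro ⟨w, hw, h0, h1⟩
    obtain ⟨e, he⟩ := Function.ne_iff.1 hw
    exact ⟨Finset.univ, w, h0, h1, e, Finset.mem_univ e, he⟩

theorem toR_mem_hullOf_of_sum {v : Fin 4 → Fin 3 → ℤ} {c : Fin 4 → ℤ} {V : ℤ} (hV : 0 < V)
    (hc : ∀ i, 0 ≤ c i) (hsum : ∑ i, c i = V) {x : Fin 3 → ℤ}
    (hx : ∑ i, c i • v i = V • x) : toR x ∈ hullOf v := by
  have hV' : (V : ℝ) ≠ 0 := by exact_mod_cast hV.ne'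
  have e : toR x = ∑ i, ((c i : ℝ) / V) • toR (v i) := by
    ext k
    have := congrArg (Int.cast : ℤ → ℝ) (congrFun hx k)
    simp only [Finset.sum_apply, Pi.smul_apply, smul_eq_mul, Int.cast_sum, Int.cast_mul] at this
    simp only [toR, Finset.sum_apply, Pi.smul_apply, smul_eq_mul]
    rw [← mul_right_inj' hV', ← this, Finset.mul_sum]
    refine Finset.sum_congr rfl fun i _ => ?_
    field_simp
  rw [e]
  refine (convex_convexHull ℝ _).sum_mem (fun i _ => ?_) ?_
    (fun i _ => subset_convexHull ℝ _ ⟨i, rfl⟩)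
  · have : (0 : ℝ) ≤ c i := by exact_mod_cast hc i
    have : (0 : ℝ) < V := by exact_mod_cast hV
    positivity
  · rw [← Finset.sum_div, div_eq_one_iff_eq hV']
    exact_mod_cast hsum

theorem exists_pos_weights {v : Fin 4 → Fin 3 → ℤ} (hv : IsOnePointSimplex v) :
    ∃ w : Fin 4 → ℝ, (∀ i, 0 < w i) ∧ ∑ i, w i = 1 ∧ ∑ i, w i • toR (v i) = 0 := by
  have htop : affineSpan ℝ (Set.range fun i => toR (v i)) = ⊤ := by
    rw [hv.1.affineSpan_eq_top_iff_card_eq_finrank_add_one]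
    simp
  let b : AffineBasis (Fin 4) ℝ (Fin 3 → ℝ) := ⟨fun i => toR (v i), hv.1, htop⟩
  have h0 : (0 : Fin 3 → ℝ) ∈ interior (convexHull ℝ (Set.range b)) := hv.2.1
  rw [b.interior_convexHull] at h0
  exact ⟨fun i => b.coord i 0, h0, b.sum_coord_apply_eq_one 0,
    b.linear_combination_coord_eq_self 0⟩

/-- The integral vectors of barycentric coordinates, scaled by the determinant of
`homogMatrix v`, of all points of the lattice `ℤ³` and their homogeneous combinations. -/
def coordLattice (v : Fin 4 → Fin 3 → ℤ) : AddSubgroup (Fin 4 → ℤ) :=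
  (Matrix.vecMulLinear (homogMatrix v).adjugate).range.toAddSubgroup

theorem mem_coordLattice {v : Fin 4 → Fin 3 → ℤ} {c : Fin 4 → ℤ} :
    c ∈ coordLattice v ↔ ∃ y, Matrix.vecMul y (homogMatrix v).adjugate = c := Iff.rfl

/-- The scaled barycentric coordinates of the origin. -/
def originCoord (v : Fin 4 → Fin 3 → ℤ) (i : Fin 4) : ℤ :=
  (homogMatrix v).det.sign * (homogMatrix v).adjugate 0 i

theorem vecMul_adjugate_vecMul {n : Type*} [Fintype n] [DecidableEq n] (M : Matrix n n ℤ)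
    (y : n → ℤ) : Matrix.vecMul (Matrix.vecMul y M.adjugate) M = M.det • y := by
  rw [Matrix.vecMul_vecMul, Matrix.adjugate_mul, Matrix.vecMul_smul, Matrix.vecMul_one]

theorem vecMul_vecMul_adjugate {n : Type*} [Fintype n] [DecidableEq n] (M : Matrix n n ℤ)
    (y : n → ℤ) : Matrix.vecMul (Matrix.vecMul y M) M.adjugate = M.det • y := by
  rw [Matrix.vecMul_vecMul, Matrix.mul_adjugate, Matrix.vecMul_smul, Matrix.vecMul_one]

theorem vecMul_homogMatrix_zero (v : Fin 4 → Fin 3 → ℤ) (c : Fin 4 → ℤ) :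
    Matrix.vecMul c (homogMatrix v) 0 = ∑ i, c i := by
  simp [Matrix.vecMul, dotProduct, homogMatrix_zero]

theorem tail_vecMul_homogMatrix (v : Fin 4 → Fin 3 → ℤ) (c : Fin 4 → ℤ) :
    Fin.tail (Matrix.vecMul c (homogMatrix v)) = ∑ i, c i • v i := by
  ext k
  simp [Fin.tail, Matrix.vecMul, dotProduct, homogMatrix_succ]

theorem det_homogMatrix_ne_zero {v : Fin 4 → Fin 3 → ℤ} (hv : IsOnePointSimplex v) :
    (homogMatrix v).det ≠ 0 :=
  (affineIndependent_iff_det_homogMatrix_ne_zero v).1 hv.1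

theorem sum_originCoord (v : Fin 4 → Fin 3 → ℤ) :
    ∑ i, originCoord v i = |(homogMatrix v).det| := by
  have h := congrFun (vecMul_adjugate_vecMul (homogMatrix v) (Pi.single 0 1)) 0
  rw [vecMul_homogMatrix_zero, Matrix.single_one_vecMul] at h
  simp only [originCoord, ← Finset.mul_sum]
  rw [← Int.sign_mul_self_eq_abs]
  congr 1
  simpa using h

theorem originCoord_pos {v : Fin 4 → Fin 3 → ℤ} (hv : IsOnePointSimplex v) (i : Fin 4) :
    0 < originCoord v i := by
  obtain ⟨w, hw, hw1, hw0⟩ := exists_pos_weights hv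
  have h1 := (vecMul_map_homogMatrix_iff v w (Pi.single 0 1)).2
    ⟨by simpa using hw1, by rw [hw0]; ext k; simp [Fin.tail]⟩
  have h2 := congrArg
    (fun y => Matrix.vecMul y ((homogMatrix v).adjugate.map fun n : ℤ => (n : ℝ)) i) h1
  have h3 : (homogMatrix v).adjugate.map (fun n : ℤ => (n : ℝ)) =
      ((homogMatrix v).map fun n : ℤ => (n : ℝ)).adjugate :=
    (Int.castRingHom ℝ).map_adjugate (homogMatrix v)
  have h4 : w i * ((homogMatrix v).det : ℝ) = (homogMatrix v).adjugate 0 i := by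
    simp only [Matrix.single_one_vecMul, Matrix.vecMul_vecMul] at h2
    rw [h3, Matrix.mul_adjugate, Matrix.vecMul_smul, Matrix.vecMul_one, det_map_homogMatrix,
      ← h3] at h2
    simpa [mul_comm] using h2
  have h5 : ((originCoord v i : ℤ) : ℝ) = w i * (|(homogMatrix v).det| : ℤ) := by
    rw [← Int.sign_mul_self_eq_abs, originCoord, Int.cast_mul, Int.cast_mul, ← h4]
    ring
  have h6 : (0 : ℝ) < (|(homogMatrix v).det| : ℤ) := by
    exact_mod_cast abs_pos.2 (det_homogMatrix_ne_zero hv)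
  exact_mod_cast h5 ▸ mul_pos (hw i) h6

theorem Int.sign_mul_sign_of_ne_zero {a : ℤ} (ha : a ≠ 0) : a.sign * a.sign = 1 := by
  rcases lt_or_gt_of_ne ha with h | h
  · simp [Int.sign_eq_neg_one_of_neg h]
  · simp [Int.sign_eq_one_of_pos h]

theorem isOnePointLattice_coordLattice {v : Fin 4 → Fin 3 → ℤ} (hv : IsOnePointSimplex v) :
    IsOnePointLattice (coordLattice v) |(homogMatrix v).det| (originCoord v) := by
  have hS := det_homogMatrix_ne_zero hv
  set S := (homogMatrix v).det with hSdef
  have hsq : S.sign * S.sign = 1 := Int.sign_mul_sign_of_ne_zero hS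
  have hsabs : S.sign * |S| = S := Int.sign_mul_abs S
  refine ⟨fun c hc => ?_, ?_, ?_, ?_, originCoord_pos hv, ?_⟩
  · choose z hz using fun i => (abs_dvd S (c i)).1 (hc i)
    refine mem_coordLattice.2 ⟨Matrix.vecMul z (homogMatrix v), ?_⟩
    rw [vecMul_vecMul_adjugate]
    ext i
    simp [hz i, hSdef]
  · rintro c ⟨y, rfl⟩
    have h := congrFun (vecMul_adjugate_vecMul (homogMatrix v) y) 0
    rw [vecMul_homogMatrix_zero, Fin.sum_univ_four] at h
    rw [abs_dvd]
    exact ⟨y 0, h⟩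
  · rintro c ⟨y, hy⟩ hc hsum
    have hy' : Matrix.vecMul y (homogMatrix v).adjugate = c := hy
    have h := vecMul_adjugate_vecMul (homogMatrix v) y
    rw [hy', ← hSdef] at h
    have hy0 : y 0 = S.sign := by
      have h0 := congrFun h 0
      rw [vecMul_homogMatrix_zero, Fin.sum_univ_four, hsum] at h0
      apply mul_left_cancel₀ hS
      rw [show S * y 0 = |S| from h0.symm, mul_comm, Int.sign_mul_self_eq_abs]
    have ht : ∑ i, c i • v i = |S| • (S.sign • Fin.tail y) := by
      rw [← tail_vecMul_homogMatrix, h, smul_smul, mul_comm, hsabs]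
      rfl
    have hy1 : y = S.sign • (Fin.cons 1 (S.sign • Fin.tail y) : Fin 4 → ℤ) := by
      refine funext fun k => Fin.cases ?_ (fun k => ?_) k
      · simp [hy0]
      · simp [Fin.tail, ← mul_assoc, hsq]
    have hmem := toR_mem_hullOf_of_sum (abs_pos.2 hS) hc
      (by rw [Fin.sum_univ_four]; exact hsum) ht
    rcases hv.2.2 _ hmem with h0 | ⟨j, hj⟩
    · left
      rw [h0] at hy1
      rw [← hy', hy1]
      have : (Fin.cons 1 0 : Fin 4 → ℤ) = Pi.single 0 1 := by
        refine funext fun k => Fin.cases ?_ (fun k => ?_) k <;> simp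
      rw [this, Matrix.smul_vecMul, Matrix.single_one_vecMul]
      rfl
    · right
      refine ⟨j, ?_⟩
      rw [hj] at hy1
      have : (Fin.cons 1 (v j) : Fin 4 → ℤ) = Matrix.vecMul (Pi.single j 1) (homogMatrix v) := by
        rw [Matrix.single_one_vecMul]
        rfl
      rw [← hy', hy1, this, Matrix.smul_vecMul, vecMul_vecMul_adjugate, ← hSdef]
      simp
  · refine mem_coordLattice.2 ⟨S.sign • Pi.single 0 1, ?_⟩
    rw [Matrix.smul_vecMul, Matrix.single_one_vecMul]
    rfl
  · rw [← Fin.sum_univ_four, sum_originCoord]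

theorem exists_mem_coordLattice_eq_one {v : Fin 4 → Fin 3 → ℤ} (hv : IsOnePointSimplex v) :
    ∃ b ∈ coordLattice v, b 0 = 1 := by
  have hS := det_homogMatrix_ne_zero hv
  have hL := isOnePointLattice_coordLattice hv
  set M := homogMatrix v with hM
  let F : (Fin 4 → ℤ) →+ ℤ :=
    { toFun := fun y => Matrix.vecMul y M.adjugate 0
      map_zero' := by simp
      map_add' := fun x y => by simp [Matrix.add_vecMul] }
  obtain ⟨k, hk⟩ := Int.subgroup_cyclic F.range
  obtain ⟨e, he⟩ : k ∈ F.range := hk ▸ AddSubgroup.mem_closure_singleton_self k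
  have hk0 : k ≠ 0 := by
    rintro rfl
    have h1 : F (M 0) ∈ F.range := ⟨_, rfl⟩
    rw [hk, AddSubgroup.closure_singleton_zero, AddSubgroup.mem_bot] at h1
    apply hS
    have h2 := congrFun (vecMul_vecMul_adjugate M (Pi.single 0 1)) 0
    rw [Matrix.single_one_vecMul] at h2
    simpa [F] using h2.symm.trans h1
  have hdet : F e = (M.updateRow 0 e).det := by
    rw [← Matrix.cramer_transpose_apply, Matrix.cramer_eq_adjugate_mulVec,
      ← Matrix.adjugate_transpose, Matrix.mulVec_transpose]
    rfl
  have hspan : ∀ y : Fin 4 → ℤ, ∃ z, Matrix.vecMul z (M.updateRow 0 e) = y := by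
    intro y
    have h1 : F y ∈ F.range := ⟨_, rfl⟩
    rw [hk, AddSubgroup.mem_closure_singleton] at h1
    obtain ⟨t, ht⟩ := h1
    have h2 : F (y - t • e) = 0 := by rw [map_sub, map_zsmul, he, ht, sub_self]
    have h3 := hL.dvd_of_dvd (mem_coordLattice.2 ⟨y - t • e, rfl⟩) (i := 0)
      (by change _ ∣ F (y - t • e); rw [h2]; exact dvd_zero _)
    choose z hz using fun i => (abs_dvd _ _).1 (h3 i)
    have h4 : Matrix.vecMul z M = y - t • e := by
      have h5 := vecMul_adjugate_vecMul M (y - t • e)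
      have h6 : Matrix.vecMul (y - t • e) M.adjugate = M.det • z := funext hz
      rw [h6, Matrix.smul_vecMul] at h5
      exact smul_right_injective _ hS h5
    have hz0 : z 0 = 0 := by
      have h5 : M.det * z 0 = 0 := by rw [← hz 0]; exact h2
      exact (mul_eq_zero.1 h5).resolve_left hS
    refine ⟨Function.update z 0 t, ?_⟩
    have h7 : y = Matrix.vecMul z M + t • e := by rw [h4]; abel
    rw [h7]
    ext j
    simp [Matrix.vecMul, dotProduct, Fin.sum_univ_succ, hz0]
    ring
  choose Z hZ using hspan
  have hunit : IsUnit (M.updateRow 0 e).det := by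
    refine IsUnit.of_mul_eq_one_right (Matrix.of fun i => Z (Pi.single i 1)).det ?_
    rw [← Matrix.det_mul]
    convert Matrix.det_one (n := Fin 4) (R := ℤ)
    ext i j
    rw [Matrix.mul_apply_eq_vecMul]
    change Matrix.vecMul (Z (Pi.single i 1)) _ j = _
    rw [hZ, Matrix.one_eq_pi_single]
  rw [← hdet] at hunit
  rcases Int.isUnit_iff.1 hunit with h | h
  · exact ⟨_, mem_coordLattice.2 ⟨e, rfl⟩, h⟩
  · exact ⟨_, mem_coordLattice.2 ⟨-e, rfl⟩, by
      change F (-e) = 1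
      rw [map_neg, h, neg_neg]⟩

theorem mult_eq_gcd {v : Fin 4 → Fin 3 → ℤ} (hv : IsOnePointSimplex v) :
    mult v = Int.gcd |(homogMatrix v).det| (originCoord v 0) := by
  have hS := det_homogMatrix_ne_zero hv
  have hL := isOnePointLattice_coordLattice hv
  obtain ⟨b, ⟨y, hy⟩, hb1⟩ := exists_mem_coordLattice_eq_one hv
  set M := homogMatrix v with hM
  let F : (Fin 4 → ℤ) →+ ℤ :=
    { toFun := fun y => Matrix.vecMul y M.adjugate 0
      map_zero' := by simp
      map_add' := fun x y => by simp [Matrix.add_vecMul] }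
  let ι : (Fin 3 → ℤ) →+ (Fin 4 → ℤ) :=
    { toFun := fun x => Fin.cons 0 x
      map_zero' := by
        refine funext fun k => Fin.cases ?_ (fun k => ?_) k <;> simp
      map_add' := fun x y => by
        refine funext fun k => Fin.cases ?_ (fun k => ?_) k <;> simp }
  let f := F.comp ι
  set a := M.adjugate 0 0 with ha
  have hcons : ∀ x : Fin 4 → ℤ, x = x 0 • Pi.single 0 1 + ι (Fin.tail x) := fun x => by
    refine funext fun k => Fin.cases ?_ (fun k => ?_) k <;> simp [ι, Fin.tail]
  have hF : ∀ x : Fin 4 → ℤ, F x = x 0 * a + f (Fin.tail x) := fun x => by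
    conv_lhs => rw [hcons x]
    rw [map_add, map_zsmul, smul_eq_mul]
    have h1 : F (Pi.single 0 1) = a := by
      change Matrix.vecMul (Pi.single 0 1) M.adjugate 0 = _
      rw [Matrix.single_one_vecMul]
      rfl
    rw [h1]
    rfl
  have hfv : ∀ i, f (v i) = M.det * (Pi.single i 1 : Fin 4 → ℤ) 0 - a := fun i => by
    have h1 : F (M i) = M.det * (Pi.single i 1 : Fin 4 → ℤ) 0 := by
      have h2 := congrFun (vecMul_vecMul_adjugate M (Pi.single i 1)) 0
      rw [Matrix.single_one_vecMul] at h2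
      exact h2
    rw [← h1, hF (M i)]
    have : Fin.tail (M i) = v i := rfl
    have h0 : M i 0 = 1 := rfl
    rw [this, h0]
    ring
  have hf0 : f (v 0) = M.det - a := by simpa using hfv 0
  have hf1 : f (v 1) = -a := by simpa using hfv 1
  have hsurj : Function.Surjective f := by
    intro t
    have h1 : F y = 1 := by rw [← hb1, ← hy]; rfl
    refine ⟨t • (y 0 • (-v 1) + Fin.tail y), ?_⟩
    rw [map_zsmul, map_add, map_zsmul, map_neg, hf1, neg_neg, smul_eq_mul, smul_eq_mul, ← hF, h1,
      mul_one]
  have hgcd : Int.gcd |M.det| (originCoord v 0) = Int.gcd M.det a := by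
    have h1 : (originCoord v 0).natAbs = a.natAbs := by
      rw [originCoord, Int.natAbs_mul, Int.natAbs_sign_of_ne_zero hS, one_mul]
    rw [Int.gcd_def, h1, Int.natAbs_abs, Int.gcd_def]
  have hcl : AddSubgroup.closure (Set.range v) =
      (AddSubgroup.zmultiples (Int.gcd M.det a : ℤ)).comap f := by
    apply le_antisymm
    · rw [AddSubgroup.closure_le]
      rintro _ ⟨i, rfl⟩
      rw [SetLike.mem_coe, AddSubgroup.mem_comap, Int.mem_zmultiples_iff, hfv]
      exact (Int.gcd_dvd_left _ _).mul_right _ |>.sub (Int.gcd_dvd_right _ _)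
    · intro x hx
      have hmem : ∀ i, v i ∈ AddSubgroup.closure (Set.range v) := fun i =>
        AddSubgroup.subset_closure ⟨i, rfl⟩
      rw [AddSubgroup.mem_comap, Int.mem_zmultiples_iff] at hx
      obtain ⟨t, ht⟩ := hx
      have hbez := Int.gcd_eq_gcd_ab M.det a
      set p := Int.gcdA M.det a
      set q := Int.gcdB M.det a
      set u := x - (t * p) • (v 0 - v 1) + (t * q) • v 1 with hu
      have hfu : f u = 0 := by
        rw [hu, map_add, map_sub, map_zsmul, map_zsmul, map_sub, hf0, hf1, ht, hbez, smul_eq_mul,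
          smul_eq_mul]
        ring
      have h3 := hL.dvd_of_dvd (mem_coordLattice.2 ⟨ι u, rfl⟩) (i := 0)
        (by change _ ∣ f u; rw [hfu]; exact dvd_zero _)
      choose z hz using fun i => (abs_dvd _ _).1 (h3 i)
      have h4 : Matrix.vecMul z M = ι u := by
        have h5 := vecMul_adjugate_vecMul M (ι u)
        have h6 : Matrix.vecMul (ι u) M.adjugate = M.det • z := funext hz
        rw [h6, Matrix.smul_vecMul] at h5
        exact smul_right_injective _ hS h5
      have h7 : u = ∑ i, z i • v i := by
        rw [← tail_vecMul_homogMatrix, ← hM, h4]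
        rfl
      have hxu : x = u + (t * p) • (v 0 - v 1) - (t * q) • v 1 := by
        rw [hu]
        abel
      rw [hxu]
      refine sub_mem (add_mem ?_ (zsmul_mem (sub_mem (hmem 0) (hmem 1)) _)) (zsmul_mem (hmem 1) _)
      rw [h7]
      exact sum_mem fun i _ => zsmul_mem (hmem i) _
  rw [mult, hcl, AddSubgroup.index_comap_of_surjective _ hsurj, Int.index_zmultiples, hgcd]
  simp

/-- The vertices of the one-point simplex of multiplicity five. -/
def extremalVertices : Fin 4 → Fin 3 → ℤ :=
  ![![1, 0, 0], ![0, 1, 0], ![1, 2, 5], ![-2, -3, -5]]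

theorem hullOf_extremalVertices : hullOf extremalVertices = convexHull ℝ
    ({toR ![(1 : ℤ), 0, 0], toR ![(0 : ℤ), 1, 0], toR ![(1 : ℤ), 2, 5],
      toR ![(-2 : ℤ), -3, -5]} : Set (Fin 3 → ℝ)) := by
  rw [hullOf]
  congr 1
  ext x
  simp only [Set.mem_range, Fin.exists_fin_succ, extremalVertices, Set.mem_insert_iff,
    Set.mem_singleton_iff, eq_comm (a := x)]
  simp

theorem toR_mulVec (A : Matrix (Fin 3) (Fin 3) ℤ) (x : Fin 3 → ℤ) :
    (A.map fun n : ℤ => (n : ℝ)).mulVec (toR x) = toR (A.mulVec x) := by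
  ext k
  simp [toR, Matrix.mulVec, dotProduct]

theorem image_hullOf (A : Matrix (Fin 3) (Fin 3) ℤ) (w : Fin 3 → ℤ) (v : Fin 4 → Fin 3 → ℤ) :
    (fun x => (A.map fun n : ℤ => (n : ℝ)).mulVec x + toR w) '' hullOf v =
      hullOf fun i => A.mulVec (v i) + w := by
  have h := AffineMap.image_convexHull (𝕜 := ℝ)
    ((A.map fun n : ℤ => (n : ℝ)).mulVecLin.toAffineMap + AffineMap.const ℝ _ (toR w))
    (Set.range fun i => toR (v i))
  rw [← Set.range_comp] at h
  refine h.trans ?_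
  rw [hullOf]
  congr 2
  ext i k
  simp [toR_mulVec, toR]

theorem hullOf_comp_perm (v : Fin 4 → Fin 3 → ℤ) (ρ : Equiv.Perm (Fin 4)) :
    hullOf (v ∘ ρ) = hullOf v := by
  rw [hullOf, hullOf]
  congr 1
  exact ρ.surjective.range_comp fun i => toR (v i)

theorem AffineIndependent.extremePoints_convexHull_range {ι E : Type*} [Finite ι]
    [NormedAddCommGroup E] [NormedSpace ℝ E] {p : ι → E} (hp : AffineIndependent ℝ p) :
    (convexHull ℝ (Set.range p)).extremePoints ℝ = Set.range p := by
  refine extremePoints_convexHull_subset.antisymm ?_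
  rintro _ ⟨i, rfl⟩
  have hsub : (convexHull ℝ (Set.range p)).extremePoints ℝ ⊆ Set.range p :=
    extremePoints_convexHull_subset
  have hfin := (Set.finite_range p).subset hsub
  have h := closure_convexHull_extremePoints ((Set.finite_range p).isCompact_convexHull ℝ)
    (convex_convexHull ℝ (Set.range p))
  rw [(hfin.isClosed_convexHull ℝ).closure_eq] at h
  have hi : p i ∈ convexHull ℝ (Set.range p) := subset_convexHull ℝ _ ⟨i, rfl⟩
  rw [← h, ← Set.image_preimage_eq_of_subset hsub] at hi
  exact (hp.mem_affineSpan_iff i _).1 (convexHull_subset_affineSpan _ hi)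

theorem exists_perm_of_hullOf_eq {u v : Fin 4 → Fin 3 → ℤ}
    (hu : AffineIndependent ℝ fun i => toR (u i)) (h : hullOf u = hullOf v) :
    ∃ ρ : Equiv.Perm (Fin 4), ∀ i, v (ρ i) = u i := by
  have hsub : (Set.range fun i => toR (u i)) ⊆ Set.range fun i => toR (v i) := by
    rw [← hu.extremePoints_convexHull_range]
    change (hullOf u).extremePoints ℝ ⊆ _
    rw [h]
    exact extremePoints_convexHull_subset
  have hex : ∀ i, ∃ j, v j = u i := fun i => by
    obtain ⟨j, hj⟩ := hsub ⟨i, rfl⟩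
    refine ⟨j, funext fun k => ?_⟩
    have := congrFun hj k
    simpa [toR] using this
  choose ρ hρ using hex
  have hinj : Function.Injective ρ := fun i j hij => by
    refine hu.injective ?_
    rw [← hρ i, ← hρ j, hij]
  exact ⟨Equiv.ofBijective ρ (Finite.injective_iff_bijective.1 hinj), hρ⟩

theorem affineIndependent_extremalVertices :
    AffineIndependent ℝ fun i => toR (extremalVertices i) := by
  rw [affineIndependent_iff_det_homogMatrix_ne_zero]
  decide +kernel

theorem mult_eq_five_of_mulVec {v : Fin 4 → Fin 3 → ℤ} {A : Matrix (Fin 3) (Fin 3) ℤ}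
    (hA : IsUnit A.det) (ρ : Equiv.Perm (Fin 4))
    (h : ∀ i, A.mulVec (v (ρ i)) = extremalVertices i) : mult v = 5 := by
  let g : (Fin 3 → ℤ) →+ ℤ := (Pi.evalAddMonoidHom (fun _ : Fin 3 => ℤ) 2).comp
    A.mulVecLin.toAddMonoidHom
  have hg : ∀ x, g x = A.mulVec x 2 := fun _ => rfl
  have hsurj : Function.Surjective g := fun t => by
    refine ⟨A⁻¹.mulVec (fun _ => t), ?_⟩
    rw [hg, Matrix.mulVec_mulVec, Matrix.mul_nonsing_inv _ hA, Matrix.one_mulVec]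
  have hcl : AddSubgroup.closure (Set.range v) = (AddSubgroup.zmultiples (5 : ℤ)).comap g := by
    apply le_antisymm
    · rw [AddSubgroup.closure_le]
      rintro _ ⟨i, rfl⟩
      obtain ⟨j, rfl⟩ := ρ.surjective i
      rw [SetLike.mem_coe, AddSubgroup.mem_comap, Int.mem_zmultiples_iff, hg, h]
      rcases fin_four_cases j with rfl | rfl | rfl | rfl <;> simp [extremalVertices]
    · intro x hx
      rw [AddSubgroup.mem_comap, Int.mem_zmultiples_iff, hg] at hx
      obtain ⟨t, ht⟩ := hx
      have hx' : x = (A.mulVec x 0 - t) • v (ρ 0) + (A.mulVec x 1 - 2 * t) • v (ρ 1) +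
          t • v (ρ 2) := by
        apply Matrix.mulVec_injective_of_isUnit ((Matrix.isUnit_iff_isUnit_det A).2 hA)
        simp only [Matrix.mulVec_add, Matrix.mulVec_smul, h]
        ext k
        fin_cases k <;> simp [extremalVertices] <;> linarith
      rw [hx']
      have hmem : ∀ i, v i ∈ AddSubgroup.closure (Set.range v) := fun i =>
        AddSubgroup.subset_closure ⟨i, rfl⟩
      exact add_mem (add_mem (zsmul_mem (hmem _) _) (zsmul_mem (hmem _) _)) (zsmul_mem (hmem _) _)
  rw [mult, hcl, AddSubgroup.index_comap_of_surjective _ hsurj, Int.index_zmultiples]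
  rfl

theorem mult_eq_five_of_unimodEquiv {v : Fin 4 → Fin 3 → ℤ} (hv : IsOnePointSimplex v)
    (h : UnimodEquiv (hullOf v) (hullOf extremalVertices)) : mult v = 5 := by
  obtain ⟨A, w, hA, hQ⟩ := h
  obtain ⟨ρ, hρ⟩ := exists_perm_of_hullOf_eq affineIndependent_extremalVertices
    (hQ.trans (image_hullOf A w v))
  have hBA : A⁻¹ * A = 1 := Matrix.nonsing_inv_mul _ hA
  have hAB : A * A⁻¹ = 1 := Matrix.mul_nonsing_inv _ hA
  have h0 : toR (0 : Fin 3 → ℤ) ∈ hullOf extremalVertices := by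
    refine toR_mem_hullOf_of_sum (c := fun _ => 1) (V := 4) (by norm_num) (by simp) (by simp) ?_
    decide +kernel
  rw [hQ] at h0
  obtain ⟨x, hx, hx0⟩ := h0
  have hxy : x = toR (A⁻¹.mulVec (-w)) := by
    have h1 : (A.map fun n : ℤ => (n : ℝ)).mulVec x = toR (-w) := by
      have h2 : toR (0 : Fin 3 → ℤ) = 0 := by ext; simp [toR]
      have h3 : toR (-w) = - toR w := by ext; simp [toR]
      rw [h3]
      exact eq_neg_of_add_eq_zero_left (hx0.trans h2)
    rw [← toR_mulVec, ← h1, Matrix.mulVec_mulVec]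
    have h4 := congrArg (fun B : Matrix (Fin 3) (Fin 3) ℤ => B.map fun n : ℤ => (n : ℝ)) hBA
    have h5 : (A⁻¹ * A).map (fun n : ℤ => (n : ℝ)) =
        A⁻¹.map (fun n : ℤ => (n : ℝ)) * A.map (fun n : ℤ => (n : ℝ)) :=
      Matrix.map_mul (f := Int.castRingHom ℝ)
    rw [← h5, hBA, Matrix.map_one _ Int.cast_zero Int.cast_one, Matrix.one_mulVec]
  have hAy : A.mulVec (A⁻¹.mulVec (-w)) = -w := by
    rw [Matrix.mulVec_mulVec, hAB, Matrix.one_mulVec]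
  have hw : w = 0 := by
    rcases hv.2.2 _ (hxy ▸ hx) with h1 | ⟨i, hi⟩
    · rw [h1, Matrix.mulVec_zero] at hAy
      exact neg_eq_zero.1 hAy.symm
    · exfalso
      obtain ⟨j, rfl⟩ := ρ.surjective i
      have h2 := hρ j
      rw [← hi, hAy, neg_add_cancel] at h2
      have h3 : ∀ j, (0 : Fin 3 → ℤ) ≠ extremalVertices j := by decide +kernel
      exact h3 j h2
  exact mult_eq_five_of_mulVec hA ρ fun i => by simpa [hw] using hρ i

theorem unimodEquiv_of_mulVec {v : Fin 4 → Fin 3 → ℤ} {A : Matrix (Fin 3) (Fin 3) ℤ}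
    (hA : IsUnit A.det) (σ : Equiv.Perm (Fin 4))
    (h : ∀ i, A.mulVec (v i) = extremalVertices (σ i)) :
    UnimodEquiv (hullOf v) (hullOf extremalVertices) := by
  refine ⟨A, 0, hA, ?_⟩
  rw [image_hullOf, ← hullOf_comp_perm extremalVertices σ]
  congr 1
  ext1 i
  rw [h, add_zero, Function.comp_apply]

/-- If `(homogMatrix v)⁻¹ * homogMatrix u` is integral, both simplices have the same normalized
volume, and the origin has the same barycentric coordinates (all equal to `1 / 4`) in both, then
a unimodular matrix maps `v` to `u`. -/
theorem exists_mulVec_eq_of_dvd {v u : Fin 4 → Fin 3 → ℤ} (hS : (homogMatrix v).det ≠ 0)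
    (hdet : |(homogMatrix u).det| = |(homogMatrix v).det|)
    (hconst : ∀ i, (homogMatrix v).adjugate 0 i = (homogMatrix v).adjugate 0 0)
    (hu : ∑ i, u i = 0)
    (hdvd : ∀ i j, (homogMatrix v).det ∣ ((homogMatrix v).adjugate * homogMatrix u) i j) :
    ∃ A : Matrix (Fin 3) (Fin 3) ℤ, IsUnit A.det ∧ ∀ i, A.mulVec (v i) = u i := by
  set M := homogMatrix v with hM
  set P := homogMatrix u with hP
  choose B hB using hdvd
  have hMP : M.adjugate * P = M.det • Matrix.of B := by
    ext i j
    exact hB i j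
  have hMB : M * Matrix.of B = P := by
    apply smul_right_injective _ hS
    change M.det • (M * Matrix.of B) = M.det • P
    rw [← Matrix.mul_smul, ← hMP, ← Matrix.mul_assoc, Matrix.mul_adjugate, Matrix.smul_mul,
      Matrix.one_mul]
  have hrow : ∀ k : Fin 3, B 0 k.succ = 0 := fun k => by
    have h1 := hB 0 k.succ
    rw [Matrix.mul_apply] at h1
    simp only [hconst, hP, homogMatrix_succ, ← Finset.mul_sum] at h1
    have h2 := congrFun hu k
    rw [Finset.sum_apply, Pi.zero_apply] at h2
    rw [h2, mul_zero] at h1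
    exact (mul_eq_zero.1 h1.symm).resolve_left hS
  have hunit : IsUnit (Matrix.of B).det := by
    rw [← hMB, Matrix.det_mul, abs_mul] at hdet
    rw [Int.isUnit_iff_abs_eq]
    exact mul_left_cancel₀ (abs_ne_zero.2 hS) (hdet.trans (mul_one _).symm)
  refine ⟨((Matrix.of B).submatrix Fin.succ Fin.succ).transpose, ?_, fun i => ?_⟩
  · rw [Matrix.det_transpose]
    rw [Matrix.det_succ_row_zero, Fin.sum_univ_succ] at hunit
    simp only [Matrix.of_apply, hrow] at hunit
    simp only [mul_zero, zero_mul, Finset.sum_const_zero, add_zero] at hunit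
    exact isUnit_of_mul_isUnit_right hunit
  · ext k
    have h1 := congrFun (congrFun hMB i) k.succ
    rw [Matrix.mul_apply, Fin.sum_univ_succ] at h1
    simp only [Matrix.of_apply, hrow, mul_zero, zero_add, hM, hP, homogMatrix_succ] at h1
    rw [← h1]
    simp [Matrix.mulVec, dotProduct, mul_comm]

theorem unimodEquiv_of_mult_eq_five {v : Fin 4 → Fin 3 → ℤ} (hv : IsOnePointSimplex v)
    (h5 : mult v = 5) : UnimodEquiv (hullOf v) (hullOf extremalVertices) := by
  have hS := det_homogMatrix_ne_zero hv
  have hL := isOnePointLattice_coordLattice hv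
  obtain ⟨b, hbL, hb0⟩ := exists_mem_coordLattice_eq_one hv
  rw [mult_eq_gcd hv] at h5
  obtain ⟨-, hV, hd, τ, hτ⟩ := (hL.gcd_eq_one_or hbL hb0).resolve_left (by omega)
  let ρ : Equiv.Perm (Fin 4) := ⟨![3, 1, 0, 2], ![2, 1, 3, 0], by decide, by decide⟩
  have hdetE : (homogMatrix extremalVertices).det.natAbs = 20 := by decide +kernel
  have hsumE : ∑ i, extremalVertices i = 0 := by decide +kernel
  have hadj : ∀ i, (homogMatrix v).adjugate 0 i = (homogMatrix v).det.sign * 5 := fun i => by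
    rw [← hd i, originCoord, ← mul_assoc, Int.sign_mul_sign_of_ne_zero hS, one_mul]
  suffices h : ∃ A : Matrix (Fin 3) (Fin 3) ℤ, IsUnit A.det ∧
      ∀ i, A.mulVec (v i) = (extremalVertices ∘ (τ.symm.trans ρ)) i by
    obtain ⟨A, hA, hAv⟩ := h
    exact unimodEquiv_of_mulVec hA _ hAv
  refine exists_mulVec_eq_of_dvd hS ?_ (fun i => by rw [hadj, hadj]) ?_ fun i j => ?_
  · have h1 : homogMatrix (extremalVertices ∘ (τ.symm.trans ρ)) =
        (homogMatrix extremalVertices).submatrix (τ.symm.trans ρ) id := rfl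
    rw [h1, Matrix.det_permute, hV, abs_mul, Int.abs_eq_natAbs (Matrix.det _), hdetE]
    rcases Int.units_eq_one_or (Equiv.Perm.sign (τ.symm.trans ρ)) with h | h <;> simp [h]
  · exact (Equiv.sum_comp (τ.symm.trans ρ) extremalVertices).trans hsumE
  · have hc : (homogMatrix v).adjugate i ∈ coordLattice v :=
      mem_coordLattice.2 ⟨Pi.single i 1, Matrix.single_one_vecMul _ _⟩
    have h0 := hL.dvd_sum_perm τ hc
    obtain ⟨h1, h2, h3⟩ := hτ _ hc
    rw [← abs_dvd, hV, Matrix.mul_apply, ← Equiv.sum_comp τ, Fin.sum_univ_four]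
    rw [hV] at h0
    refine Fin.cases ?_ (fun k => ?_) j
    · simpa [homogMatrix_zero] using h0
    · simp only [homogMatrix_succ, Function.comp_apply, Equiv.trans_apply, Equiv.symm_apply_apply]
      fin_cases k <;> simp [ρ, extremalVertices] <;> omega

/-- A three-dimensional one-point lattice simplex has multiplicity at most `5`,
with equality iff it is unimodularly equivalent to
`conv{(1,0,0), (0,1,0), (1,2,5), (-2,-3,-5)}`. -/
theorem onePoint_simplex_mult_dim3 (v : Fin 4 → Fin 3 → ℤ) (hv : IsOnePointSimplex v) :
    mult v ≤ 5 ∧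
      (mult v = 5 ↔
        UnimodEquiv (hullOf v)
          (convexHull ℝ
            ({toR ![(1 : ℤ), 0, 0], toR ![(0 : ℤ), 1, 0], toR ![(1 : ℤ), 2, 5],
              toR ![(-2 : ℤ), -3, -5]} : Set (Fin 3 → ℝ)))) := by
  have hgcd := (isOnePointLattice_coordLattice hv).gcd_eq_one_or
    (exists_mem_coordLattice_eq_one hv).choose_spec.1
    (exists_mem_coordLattice_eq_one hv).choose_spec.2
  rw [← hullOf_extremalVertices]
  refine ⟨?_, unimodEquiv_of_mult_eq_five hv, mult_eq_five_of_unimodEquiv hv⟩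
  rw [mult_eq_gcd hv]
  rcases hgcd with h | ⟨h, -⟩ <;> omega
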